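/- Let n ≥ 5 be odd and let C_n be the circular tournament on vertex set ℤ/nℤ, with an edge i → j iff (j − i) mod n ∈ {1, …, (n−1)/2}. Then no 4-element vertex subset of C_n induces a subtournament isomorphic to W₄ or to L₄; that is, w₄(C_n) = l₄(C_n) = 0 and every 4-subset induces T₄ or C₄. -/

import Mathlib

open Finset

/-- A tournament: an irreflexive relation such that for distinct vertices exactly one of
`r x y`, `r y x` holds. -/
def IsTournament {V : Type} (r : V → V → Prop) : Prop :=
  (∀ x, ¬ r x x) ∧ ∀ x y : V, x ≠ y → (r x y ↔ ¬ r y x)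

/-- The transitive tournament on 4 vertices. -/
def T4rel : Fin 4 → Fin 4 → Prop := fun i j => i < j

/-- The unique strongly connected tournament on 4 vertices. -/
def C4rel : Fin 4 → Fin 4 → Prop := fun i j =>
  (i = 0 ∧ j = 1) ∨ (i = 1 ∧ j = 2) ∨ (i = 2 ∧ j = 3) ∨ (i = 3 ∧ j = 0) ∨
  (i = 0 ∧ j = 2) ∨ (i = 1 ∧ j = 3)

/-- The 4-vertex tournament in which a cyclic triangle beats a fourth vertex. -/
def W4rel : Fin 4 → Fin 4 → Prop := fun i j =>
  (i = 0 ∧ j = 1) ∨ (i = 1 ∧ j = 2) ∨ (i = 2 ∧ j = 0) ∨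
  (i = 0 ∧ j = 3) ∨ (i = 1 ∧ j = 3) ∨ (i = 2 ∧ j = 3)

/-- The 4-vertex tournament in which one vertex beats a cyclic triangle. -/
def L4rel : Fin 4 → Fin 4 → Prop := fun i j =>
  (i = 0 ∧ j = 1) ∨ (i = 1 ∧ j = 2) ∨ (i = 2 ∧ j = 0) ∨
  (i = 3 ∧ j = 0) ∨ (i = 3 ∧ j = 1) ∨ (i = 3 ∧ j = 2)

/-- The cyclic triangle (directed 3-cycle). -/
def C3rel : Fin 3 → Fin 3 → Prop := fun i j =>
  (i = 0 ∧ j = 1) ∨ (i = 1 ∧ j = 2) ∨ (i = 2 ∧ j = 0)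

/-- `s` induces a subtournament isomorphic to the pattern `m`. -/
def InducesPattern {V : Type} {k : ℕ} (r : V → V → Prop) (m : Fin k → Fin k → Prop)
    (s : Finset V) : Prop :=
  ∃ f : Fin k → V, Function.Injective f ∧ Set.range f = (s : Set V) ∧
    ∀ i j : Fin k, m i j ↔ r (f i) (f j)

-- the number of `k`-element vertex subsets inducing a copy of the pattern `m`
open Classical in
noncomputable def patternCount {V : Type} [Fintype V] {k : ℕ} (r : V → V → Prop)
    (m : Fin k → Fin k → Prop) : ℕ :=
  (((univ : Finset V).powersetCard k).filter (fun s => InducesPattern r m s)).card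

-- the probability that a uniformly random `k`-element vertex subset induces a copy of `m`
noncomputable def patternDensity {V : Type} [Fintype V] {k : ℕ} (r : V → V → Prop)
    (m : Fin k → Fin k → Prop) : ℝ :=
  (patternCount r m : ℝ) / ((Fintype.card V).choose k)

/-- The circular tournament on `n` vertices (for odd `n`): `i → j` iff the clockwise
distance from `i` to `j` is between `1` and `(n-1)/2`. -/
def circRel (n : ℕ) : Fin n → Fin n → Prop := fun i j =>
  1 ≤ (j.val + n - i.val) % n ∧ (j.val + n - i.val) % n ≤ (n - 1) / 2

theorem circRel_iff_aux (n m : ℕ) (hm : n = 2 * m + 1) (i j : Fin n) :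
    circRel n i j ↔ (i.val < j.val ∧ j.val ≤ i.val + m) ∨
      (j.val < i.val ∧ j.val + m + 1 ≤ i.val) := by
  have hi := i.isLt
  have hj := j.isLt
  unfold circRel
  rcases lt_or_ge j.val i.val with h | h
  · rw [Nat.mod_eq_of_lt (by omega)]
    omega
  · have : j.val + n - i.val = (j.val - i.val) + n := by omega
    rw [this, Nat.add_mod_right, Nat.mod_eq_of_lt (by omega)]
    omega

theorem no_W4_aux (n m : ℕ) (hm : n = 2 * m + 1) (s : Finset (Fin n)) :
    ¬ InducesPattern (circRel n) W4rel s := by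
  rintro ⟨f, -, -, h⟩
  have h1 := (h 0 1).1 (by simp [W4rel])
  have h2 := (h 1 2).1 (by simp [W4rel])
  have h3 := (h 2 0).1 (by simp [W4rel])
  have h4 := (h 0 3).1 (by simp [W4rel])
  have h5 := (h 1 3).1 (by simp [W4rel])
  have h6 := (h 2 3).1 (by simp [W4rel])
  rw [circRel_iff_aux n m hm] at h1 h2 h3 h4 h5 h6
  omega

theorem no_L4_aux (n m : ℕ) (hm : n = 2 * m + 1) (s : Finset (Fin n)) :
    ¬ InducesPattern (circRel n) L4rel s := by
  rintro ⟨f, -, -, h⟩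
  have h1 := (h 0 1).1 (by simp [L4rel])
  have h2 := (h 1 2).1 (by simp [L4rel])
  have h3 := (h 2 0).1 (by simp [L4rel])
  have h4 := (h 3 0).1 (by simp [L4rel])
  have h5 := (h 3 1).1 (by simp [L4rel])
  have h6 := (h 3 2).1 (by simp [L4rel])
  rw [circRel_iff_aux n m hm] at h1 h2 h3 h4 h5 h6
  omega

/-- A pattern is induced as soon as its six edges are correctly oriented (transitive). -/
theorem induces_T4_aux (n m : ℕ) (hm : n = 2 * m + 1) (a b c d : Fin n)
    (hab : circRel n a b) (hac : circRel n a c) (had : circRel n a d)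
    (hbc : circRel n b c) (hbd : circRel n b d) (hcd : circRel n c d) :
    InducesPattern (circRel n) T4rel {a, b, c, d} := by
  rw [circRel_iff_aux n m hm] at hab hac had hbc hbd hcd
  refine ⟨![a, b, c, d], ?_, ?_, ?_⟩
  · intro i j hij
    fin_cases i <;> fin_cases j <;> simp [Fin.ext_iff] at hij ⊢ <;> omega
  · ext x
    clear hab hac had hbc hbd hcd
    simp [eq_comm]
    tauto
  · intro i j
    rw [circRel_iff_aux n m hm]
    fin_cases i <;> fin_cases j <;> simp [T4rel] <;> omega

/-- A pattern is induced as soon as its six edges are correctly oriented (strong). -/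
theorem induces_C4_aux (n m : ℕ) (hm : n = 2 * m + 1) (a b c d : Fin n)
    (hab : circRel n a b) (hac : circRel n a c) (had : circRel n d a)
    (hbc : circRel n b c) (hbd : circRel n b d) (hcd : circRel n c d) :
    InducesPattern (circRel n) C4rel {a, b, c, d} := by
  rw [circRel_iff_aux n m hm] at hab hac had hbc hbd hcd
  refine ⟨![a, b, c, d], ?_, ?_, ?_⟩
  · intro i j hij
    fin_cases i <;> fin_cases j <;> simp [Fin.ext_iff] at hij ⊢ <;> omega
  · ext x
    clear hab hac had hbc hbd hcd
    simp [eq_comm]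
    tauto
  · intro i j
    rw [circRel_iff_aux n m hm]
    fin_cases i <;> fin_cases j <;> simp [C4rel] <;> omega

theorem T4_or_C4_aux (n m : ℕ) (hm : n = 2 * m + 1) (a b c d : Fin n)
    (hab : a.val < b.val) (hbc : b.val < c.val) (hcd : c.val < d.val) :
    InducesPattern (circRel n) T4rel {a, b, c, d} ∨
      InducesPattern (circRel n) C4rel {a, b, c, d} := by
  have hd := d.isLt
  have r1 : ({a, b, c, d} : Finset (Fin n)) = {b, c, d, a} := by ext; simp; tauto
  have r2 : ({a, b, c, d} : Finset (Fin n)) = {c, d, a, b} := by ext; simp; tauto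
  have r3 : ({a, b, c, d} : Finset (Fin n)) = {d, a, b, c} := by ext; simp; tauto
  have key := circRel_iff_aux n m hm
  by_cases had : d.val ≤ a.val + m
  · left
    apply induces_T4_aux n m hm <;> rw [key] <;> omega
  by_cases hac : c.val ≤ a.val + m <;> by_cases hbd : d.val ≤ b.val + m
  · right
    apply induces_C4_aux n m hm <;> rw [key] <;> omega
  · rw [r3]
    by_cases h : d.val ≤ c.val + m
    · right
      apply induces_C4_aux n m hm <;> rw [key] <;> omega
    · left
      apply induces_T4_aux n m hm <;> rw [key] <;> omega
  · rw [r1]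
    by_cases h : b.val ≤ a.val + m
    · right
      apply induces_C4_aux n m hm <;> rw [key] <;> omega
    · left
      apply induces_T4_aux n m hm <;> rw [key] <;> omega
  · rw [r2]
    by_cases h : c.val ≤ b.val + m
    · right
      apply induces_C4_aux n m hm <;> rw [key] <;> omega
    · left
      apply induces_T4_aux n m hm <;> rw [key] <;> omega

/-- In a circular tournament (on an odd number `n ≥ 5` of vertices) no 4-element subset
induces `W₄` or `L₄`: every 4-subset induces `T₄` or `C₄`, and `w₄ = l₄ = 0`. -/
theorem circular_tournament_no_W4_no_L4 (n : ℕ) (hodd : Odd n) (hn : 5 ≤ n) :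
    (∀ s ∈ (univ : Finset (Fin n)).powersetCard 4,
      ¬ InducesPattern (circRel n) W4rel s ∧ ¬ InducesPattern (circRel n) L4rel s ∧
      (InducesPattern (circRel n) T4rel s ∨ InducesPattern (circRel n) C4rel s)) ∧
    patternDensity (circRel n) W4rel = 0 ∧ patternDensity (circRel n) L4rel = 0 := by
  obtain ⟨m, hm⟩ := hodd
  refine ⟨fun s hs => ⟨no_W4_aux n m hm s, no_L4_aux n m hm s, ?_⟩, ?_, ?_⟩
  · have hc : s.card = 4 := (Finset.mem_powersetCard.1 hs).2
    have hr := Finset.range_orderEmbOfFin s hc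
    have hlt : ∀ i j : Fin 4, i < j →
        (s.orderEmbOfFin hc i).val < (s.orderEmbOfFin hc j).val :=
      fun i j hij => (s.orderEmbOfFin hc).strictMono hij
    have hs4 : s = {s.orderEmbOfFin hc 0, s.orderEmbOfFin hc 1,
        s.orderEmbOfFin hc 2, s.orderEmbOfFin hc 3} := by
      ext x
      rw [← Finset.mem_coe, ← hr]
      simp only [Set.mem_range, Finset.mem_insert, Finset.mem_singleton]
      constructor
      · rintro ⟨i, rfl⟩
        fin_cases i <;> simp
      · rintro (h | h | h | h) <;> exact ⟨_, h.symm⟩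
    have := T4_or_C4_aux n m hm _ _ _ _ (hlt 0 1 (by decide)) (hlt 1 2 (by decide))
      (hlt 2 3 (by decide))
    rwa [← hs4] at this
  · simp [patternDensity, patternCount, no_W4_aux n m hm]
  · simp [patternDensity, patternCount, no_L4_aux n m hm]
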